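/- Let ≺ be an admissible order on FreeMonoid σ, and let rev : A → A be the K-linear bijection of A = FreeAlgebra K σ induced by word reversal on the word basis (so rev is an anti-automorphism: rev(a*b) = rev(b)*rev(a)). Define the order ≺ᵒᵖ on FreeMonoid σ by p ≺ᵒᵖ q if and only if reverse(p) ≺ reverse(q). Then ≺ᵒᵖ is an admissible order; for every two-sided ideal I of A the image rev(I) is a two-sided ideal with tip of rev(I) with respect to ≺ᵒᵖ equal to the set of reversals of the words in tip of I with respect to ≺; and consequently a set G ⊆ I is a Gröbner basis of I with respect to ≺ if and only if rev(G) is a Gröbner basis of rev(I) with respect to ≺ᵒᵖ. -/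

import Mathlib

open scoped TensorProduct

noncomputable section

/-- The embedding of words into the free algebra, sending a word to the product of the
corresponding generators. -/
def wordEmb (K : Type*) [Field K] (σ : Type*) : FreeMonoid σ →* FreeAlgebra K σ :=
  FreeMonoid.lift (FreeAlgebra.ι K)

/-- The coefficient function of an element of the free algebra with respect to the word basis. -/
def coeffw (K : Type*) [Field K] (σ : Type*) (x : FreeAlgebra K σ) : FreeMonoid σ →₀ K :=
  (FreeAlgebra.basisFreeMonoid K σ).repr x

/-- A `K`-submodule of the free algebra is a two-sided ideal if it is closed under
left and right multiplication by arbitrary elements. -/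
def IsIdeal2 (K : Type*) [Field K] (σ : Type*) (I : Submodule K (FreeAlgebra K σ)) : Prop :=
  ∀ a b : FreeAlgebra K σ, ∀ x ∈ I, a * x * b ∈ I

/-- The two-sided ideal generated by a set `S`. -/
def idealGen (K : Type*) [Field K] (σ : Type*) (S : Set (FreeAlgebra K σ)) :
    Submodule K (FreeAlgebra K σ) :=
  Submodule.span K {x | ∃ a s b, s ∈ S ∧ x = a * s * b}

/-- `lt` is an admissible order on `FreeMonoid σ`: a well-order compatible with
multiplication on both sides, and such that a word is ≤ any word containing it as a factor. -/
structure IsAdmissibleOrder {σ : Type*} (lt : FreeMonoid σ → FreeMonoid σ → Prop) : Prop where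
  isWellOrder : IsWellOrder (FreeMonoid σ) lt
  mul_right : ∀ p q r : FreeMonoid σ, lt p q → lt (p * r) (q * r)
  mul_left : ∀ p q s : FreeMonoid σ, lt p q → lt (s * p) (s * q)
  le_mul : ∀ q r s : FreeMonoid σ, q = r * q * s ∨ lt q (r * q * s)

/-- A length admissible order is an admissible order in which longer words are larger. -/
structure IsLengthAdmissibleOrder {σ : Type*} (lt : FreeMonoid σ → FreeMonoid σ → Prop)
    extends IsAdmissibleOrder lt : Prop where
  length_lt : ∀ p q : FreeMonoid σ, p.length < q.length → lt p q

/-- `t` is the tip (the largest word of the support with respect to `lt`) of `x`. -/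
def IsTipOf (K : Type*) [Field K] {σ : Type*} (lt : FreeMonoid σ → FreeMonoid σ → Prop)
    (t : FreeMonoid σ) (x : FreeAlgebra K σ) : Prop :=
  coeffw K σ x t ≠ 0 ∧ ∀ u, coeffw K σ x u ≠ 0 → u = t ∨ lt u t

/-- The set of tips of the nonzero elements of `S`. -/
def tipSet (K : Type*) [Field K] {σ : Type*} (lt : FreeMonoid σ → FreeMonoid σ → Prop)
    (S : Set (FreeAlgebra K σ)) : Set (FreeMonoid σ) :=
  {t | ∃ x ∈ S, IsTipOf K lt t x}

/-- The set of nontips of `S`: words which are not a tip of an element of `S`. -/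
def nontipSet (K : Type*) [Field K] {σ : Type*} (lt : FreeMonoid σ → FreeMonoid σ → Prop)
    (S : Set (FreeAlgebra K σ)) : Set (FreeMonoid σ) :=
  {w | w ∉ tipSet K lt S}

/-- `G` is a Gröbner basis of the two-sided ideal `I` with respect to `lt`. -/
def IsGrobnerBasis (K : Type*) [Field K] {σ : Type*}
    (lt : FreeMonoid σ → FreeMonoid σ → Prop) (G : Set (FreeAlgebra K σ))
    (I : Submodule K (FreeAlgebra K σ)) : Prop :=
  G ⊆ ↑I ∧ idealGen K σ (wordEmb K σ '' tipSet K lt G) = idealGen K σ (wordEmb K σ '' tipSet K lt ↑I)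

/-- `x` is homogeneous of degree `d`: every word in its support has length `d`. -/
def IsHomogOfDeg (K : Type*) [Field K] {σ : Type*} (x : FreeAlgebra K σ) (d : ℕ) : Prop :=
  ∀ w : FreeMonoid σ, coeffw K σ x w ≠ 0 → w.length = d


/-- Reversal of a word. -/
def wordRev {σ : Type*} (w : FreeMonoid σ) : FreeMonoid σ :=
  FreeMonoid.ofList (FreeMonoid.toList w).reverse

/-- The `K`-linear map on the free algebra induced by word reversal on the word basis. -/
def revMap (K : Type*) [Field K] (σ : Type*) : FreeAlgebra K σ →ₗ[K] FreeAlgebra K σ :=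
  (FreeAlgebra.basisFreeMonoid K σ).constr K (fun w => wordEmb K σ (wordRev w))

/-- The opposite order: `p ≺ᵒᵖ q` iff `reverse p ≺ reverse q`. -/
def opOrd {σ : Type*} (lt : FreeMonoid σ → FreeMonoid σ → Prop) :
    FreeMonoid σ → FreeMonoid σ → Prop :=
  fun p q => lt (wordRev p) (wordRev q)

theorem wordRev_wordRev {σ : Type*} (w : FreeMonoid σ) : wordRev (wordRev w) = w :=
  List.reverse_reverse (as := FreeMonoid.toList w)

theorem wordRev_mul {σ : Type*} (v w : FreeMonoid σ) :
    wordRev (v * w) = wordRev w * wordRev v :=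
  List.reverse_append (as := FreeMonoid.toList v) (bs := FreeMonoid.toList w)

theorem wordRev_inj {σ : Type*} : Function.Injective (wordRev (σ := σ)) :=
  Function.LeftInverse.injective wordRev_wordRev

theorem basis_eq_wordEmb (K : Type*) [Field K] (σ : Type*) (w : FreeMonoid σ) :
    FreeAlgebra.basisFreeMonoid K σ w = wordEmb K σ w := by
  simp [FreeAlgebra.basisFreeMonoid, wordEmb, FreeAlgebra.equivMonoidAlgebraFreeMonoid]

theorem revMap_wordEmb (K : Type*) [Field K] (σ : Type*) (w : FreeMonoid σ) :
    revMap K σ (wordEmb K σ w) = wordEmb K σ (wordRev w) := by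
  rw [← basis_eq_wordEmb, revMap, Module.Basis.constr_basis]

theorem revMap_revMap (K : Type*) [Field K] (σ : Type*) (x : FreeAlgebra K σ) :
    revMap K σ (revMap K σ x) = x := by
  have h : (revMap K σ).comp (revMap K σ) = LinearMap.id := by
    refine (FreeAlgebra.basisFreeMonoid K σ).ext fun w => ?_
    simp [basis_eq_wordEmb, revMap_wordEmb, wordRev_wordRev]
  exact LinearMap.congr_fun h x

theorem revMap_inj (K : Type*) [Field K] (σ : Type*) : Function.Injective (revMap K σ) :=
  Function.LeftInverse.injective (revMap_revMap K σ)

theorem revMap_mul (K : Type*) [Field K] (σ : Type*) (a b : FreeAlgebra K σ) :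
    revMap K σ (a * b) = revMap K σ b * revMap K σ a := by
  have h : (LinearMap.mul K (FreeAlgebra K σ)).compr₂ (revMap K σ) =
      ((LinearMap.mul K (FreeAlgebra K σ)).compl₁₂ (revMap K σ) (revMap K σ)).flip := by
    refine (FreeAlgebra.basisFreeMonoid K σ).ext fun v => ?_
    refine (FreeAlgebra.basisFreeMonoid K σ).ext fun w => ?_
    simp only [basis_eq_wordEmb, LinearMap.compr₂_apply, LinearMap.flip_apply,
      LinearMap.compl₁₂_apply, LinearMap.mul_apply', revMap_wordEmb]
    rw [← map_mul, ← map_mul, revMap_wordEmb, wordRev_mul]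
  exact LinearMap.congr_fun (LinearMap.congr_fun h a) b

theorem coeffw_revMap (K : Type*) [Field K] (σ : Type*) (x : FreeAlgebra K σ)
    (w : FreeMonoid σ) : coeffw K σ (revMap K σ x) (wordRev w) = coeffw K σ x w := by
  have h : ((FreeAlgebra.basisFreeMonoid K σ).coord (wordRev w)).comp (revMap K σ) =
      (FreeAlgebra.basisFreeMonoid K σ).coord w := by
    refine (FreeAlgebra.basisFreeMonoid K σ).ext fun v => ?_
    rw [LinearMap.comp_apply, basis_eq_wordEmb, revMap_wordEmb, ← basis_eq_wordEmb,
      ← basis_eq_wordEmb]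
    classical
    rw [Module.Basis.coord_apply, Module.Basis.coord_apply, Module.Basis.repr_self,
      Module.Basis.repr_self, Finsupp.single_apply, Finsupp.single_apply]
    simp only [wordRev_inj.eq_iff]
  exact LinearMap.congr_fun h x

theorem isTipOf_revMap (K : Type*) [Field K] {σ : Type*}
    (lt : FreeMonoid σ → FreeMonoid σ → Prop) (t : FreeMonoid σ) (x : FreeAlgebra K σ) :
    IsTipOf K (opOrd lt) (wordRev t) (revMap K σ x) ↔ IsTipOf K lt t x := by
  unfold IsTipOf opOrd
  rw [coeffw_revMap]
  refine and_congr_right fun _ => ⟨fun h u hu => ?_, fun h u hu => ?_⟩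
  · have := h (wordRev u) (by rwa [coeffw_revMap])
    simpa [wordRev_wordRev, wordRev_inj.eq_iff] using this
  · rw [← wordRev_wordRev u, coeffw_revMap] at hu
    have := h _ hu
    rw [wordRev_wordRev]
    refine this.imp (fun h => ?_) id
    rw [← h, wordRev_wordRev]

theorem tipSet_revMap (K : Type*) [Field K] {σ : Type*}
    (lt : FreeMonoid σ → FreeMonoid σ → Prop) (S : Set (FreeAlgebra K σ)) :
    tipSet K (opOrd lt) (revMap K σ '' S) = wordRev '' tipSet K lt S := by
  ext t
  constructor
  · rintro ⟨_, ⟨x, hx, rfl⟩, ht⟩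
    refine ⟨wordRev t, ⟨x, hx, ?_⟩, wordRev_wordRev t⟩
    rwa [← isTipOf_revMap, wordRev_wordRev]
  · rintro ⟨t, ⟨x, hx, ht⟩, rfl⟩
    exact ⟨_, ⟨x, hx, rfl⟩, (isTipOf_revMap K lt t x).2 ht⟩

theorem idealGen_revMap (K : Type*) [Field K] (σ : Type*) (S : Set (FreeAlgebra K σ)) :
    idealGen K σ (revMap K σ '' S) = Submodule.map (revMap K σ) (idealGen K σ S) := by
  unfold idealGen
  rw [Submodule.map_span]
  congr 1
  ext x
  constructor
  · rintro ⟨a, _, b, ⟨s, hs, rfl⟩, rfl⟩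
    refine ⟨revMap K σ b * s * revMap K σ a, ⟨_, s, _, hs, rfl⟩, ?_⟩
    simp only [revMap_mul, revMap_revMap, mul_assoc]
  · rintro ⟨_, ⟨a, s, b, hs, rfl⟩, rfl⟩
    refine ⟨revMap K σ b, _, revMap K σ a, ⟨s, hs, rfl⟩, ?_⟩
    simp only [revMap_mul, mul_assoc]

theorem wordEmb_image_rev (K : Type*) [Field K] (σ : Type*) (T : Set (FreeMonoid σ)) :
    wordEmb K σ '' (wordRev '' T) = revMap K σ '' (wordEmb K σ '' T) := by
  simp only [Set.image_image, revMap_wordEmb]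

theorem opOrd_admissible {σ : Type*} (lt : FreeMonoid σ → FreeMonoid σ → Prop)
    (hlt : IsAdmissibleOrder lt) : IsAdmissibleOrder (opOrd lt) where
  isWellOrder := by
    have := hlt.isWellOrder
    let e : opOrd lt ↪r lt := ⟨⟨wordRev, wordRev_inj⟩, Iff.rfl⟩
    exact e.isWellOrder
  mul_right p q r h := by
    unfold opOrd at *
    rw [wordRev_mul, wordRev_mul]
    exact hlt.mul_left _ _ _ h
  mul_left p q r h := by
    unfold opOrd at *
    rw [wordRev_mul, wordRev_mul]
    exact hlt.mul_right _ _ _ h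
  le_mul q r s := by
    unfold opOrd
    have h := hlt.le_mul (wordRev q) (wordRev s) (wordRev r)
    have e : wordRev (r * q * s) = wordRev s * wordRev q * wordRev r := by
      simp only [wordRev_mul, mul_assoc]
    rw [← e] at h
    exact h.imp (fun h => wordRev_inj h) id

/-- `rev` is a `K`-linear bijective anti-automorphism, `≺ᵒᵖ` is admissible,
`rev I` is a two-sided ideal with tips the reversed tips of `I`, and `G` is a Gröbner basis
of `I` w.r.t. `≺` iff `rev G` is one of `rev I` w.r.t. `≺ᵒᵖ`. -/
theorem stmt13 (K : Type*) [Field K] (σ : Type*)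
    (lt : FreeMonoid σ → FreeMonoid σ → Prop) (hlt : IsAdmissibleOrder lt) :
    Function.Bijective (revMap K σ) ∧
    (∀ a b : FreeAlgebra K σ, revMap K σ (a * b) = revMap K σ b * revMap K σ a) ∧
    IsAdmissibleOrder (opOrd lt) ∧
    (∀ I : Submodule K (FreeAlgebra K σ), IsIdeal2 K σ I →
      IsIdeal2 K σ (Submodule.map (revMap K σ) I) ∧
      tipSet K (opOrd lt) ((Submodule.map (revMap K σ) I : Set (FreeAlgebra K σ)))
        = wordRev '' tipSet K lt (I : Set (FreeAlgebra K σ)) ∧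
      (∀ G : Set (FreeAlgebra K σ), G ⊆ (I : Set (FreeAlgebra K σ)) →
        (IsGrobnerBasis K lt G I ↔
          IsGrobnerBasis K (opOrd lt) (revMap K σ '' G) (Submodule.map (revMap K σ) I)))) := by
  refine ⟨⟨revMap_inj K σ, fun x => ⟨_, revMap_revMap K σ x⟩⟩, revMap_mul K σ,
    opOrd_admissible lt hlt, fun I hI => ⟨?_, ?_, fun G hG => ?_⟩⟩
  · rintro a b _ ⟨x, hx, rfl⟩
    refine ⟨revMap K σ b * x * revMap K σ a, hI _ _ x hx, ?_⟩
    simp only [revMap_mul, revMap_revMap, mul_assoc]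
  · rw [Submodule.map_coe, tipSet_revMap]
  · unfold IsGrobnerBasis
    rw [Submodule.map_coe, tipSet_revMap, tipSet_revMap, wordEmb_image_rev, wordEmb_image_rev,
      idealGen_revMap, idealGen_revMap,
      (Submodule.map_injective_of_injective (revMap_inj K σ)).eq_iff,
      Set.image_subset_image_iff (revMap_inj K σ)]
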